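/- arXiv:1712.00286 — 12 statements merged into one kernel-verified Lean document; each statement's English description precedes it below -/
import Mathlib

section
/- Let u₁, u₂ : ℝ → ℝ be twice differentiable. Then the Wronskian of the three functions u₁², u₁u₂, u₂² (i.e., the determinant of the 3×3 matrix whose rows are (u₁², u₁u₂, u₂²) together with their first and second derivatives) equals 2(u₁u̇₂ − u₂u̇₁)³ at every point of ℝ. -/
/-- The second-order Leibniz rule for real functions. -/
theorem deriv_deriv_fun_mul {f g : ℝ → ℝ}
    (hf : Differentiable ℝ f) (hf' : Differentiable ℝ (deriv f))
    (hg : Differentiable ℝ g) (hg' : Differentiable ℝ (deriv g)) (t : ℝ) :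
    deriv (deriv fun s => f s * g s) t =
      deriv (deriv f) t * g t + 2 * (deriv f t * deriv g t) + f t * deriv (deriv g) t := by
  have h : (deriv fun s => f s * g s) = fun s => deriv f s * g s + f s * deriv g s :=
    funext fun s => deriv_fun_mul (hf s) (hg s)
  rw [h, (((hf' t).hasDerivAt.fun_mul (hg t).hasDerivAt).fun_add
    ((hf t).hasDerivAt.fun_mul (hg' t).hasDerivAt)).deriv]
  ring

/-- For twice differentiable `u₁, u₂ : ℝ → ℝ`, the Wronskian of the
three functions `u₁², u₁u₂, u₂²` equals `2(u₁u̇₂ − u₂u̇₁)³` at every point. -/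
theorem wronskian_of_squares_eq_two_wronskian_cubed
    (u₁ u₂ : ℝ → ℝ)
    (hu₁ : Differentiable ℝ u₁) (hu₁' : Differentiable ℝ (deriv u₁))
    (hu₂ : Differentiable ℝ u₂) (hu₂' : Differentiable ℝ (deriv u₂))
    (f₁ f₂ f₃ : ℝ → ℝ)
    (hf₁ : f₁ = fun t => u₁ t ^ 2)
    (hf₂ : f₂ = fun t => u₁ t * u₂ t)
    (hf₃ : f₃ = fun t => u₂ t ^ 2) :
    ∀ t : ℝ,
      Matrix.det !![f₁ t, f₂ t, f₃ t;
                    deriv f₁ t, deriv f₂ t, deriv f₃ t;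
                    deriv (deriv f₁) t, deriv (deriv f₂) t, deriv (deriv f₃) t]
        = 2 * (u₁ t * deriv u₂ t - u₂ t * deriv u₁ t) ^ 3 := by
  intro t
  subst hf₁ hf₂ hf₃
  simp only [pow_two]
  rw [deriv_deriv_fun_mul hu₁ hu₁' hu₁ hu₁', deriv_deriv_fun_mul hu₁ hu₁' hu₂ hu₂',
    deriv_deriv_fun_mul hu₂ hu₂' hu₂ hu₂', deriv_fun_mul (hu₁ t) (hu₁ t),
    deriv_fun_mul (hu₁ t) (hu₂ t), deriv_fun_mul (hu₂ t) (hu₂ t), Matrix.det_fin_three]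
  simp only [Matrix.of_apply, Matrix.cons_val]
  ring
end

section
/- Let p : ℝ → ℝ be differentiable and let a₁, a₂ : ℝ → ℝ be three times differentiable solutions of the projective vector field equation a''' + 4p(t)a' + 2ṗ(t)a = 0 on ℝ. Then the Wronskian w₁₂(t) = a₁(t)ȧ₂(t) − a₂(t)ȧ₁(t) is three times differentiable and is also a solution of the same equation: w₁₂''' + 4p(t)w₁₂' + 2ṗ(t)w₁₂ = 0 for all t ∈ ℝ. -/
/-- If `a₁, a₂` are three times differentiable solutions of the
projective vector field equation `a''' + 4p a' + 2p' a = 0` (with `p` differentiable),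
then their Wronskian `w₁₂ = a₁ȧ₂ − a₂ȧ₁` is three times differentiable and is also
a solution of the same equation. -/
theorem wronskian_of_projective_solutions_is_solution
    (p a₁ a₂ : ℝ → ℝ) (hp : Differentiable ℝ p)
    (ha₁ : Differentiable ℝ a₁) (ha₁' : Differentiable ℝ (deriv a₁))
    (ha₁'' : Differentiable ℝ (deriv (deriv a₁)))
    (ha₂ : Differentiable ℝ a₂) (ha₂' : Differentiable ℝ (deriv a₂))
    (ha₂'' : Differentiable ℝ (deriv (deriv a₂)))
    (heq₁ : ∀ t : ℝ, deriv (deriv (deriv a₁)) t + 4 * p t * deriv a₁ t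
      + 2 * deriv p t * a₁ t = 0)
    (heq₂ : ∀ t : ℝ, deriv (deriv (deriv a₂)) t + 4 * p t * deriv a₂ t
      + 2 * deriv p t * a₂ t = 0)
    (w : ℝ → ℝ) (hw : w = fun t => a₁ t * deriv a₂ t - a₂ t * deriv a₁ t) :
    (Differentiable ℝ w ∧ Differentiable ℝ (deriv w) ∧
      Differentiable ℝ (deriv (deriv w))) ∧
    ∀ t : ℝ, deriv (deriv (deriv w)) t + 4 * p t * deriv w t
      + 2 * deriv p t * w t = 0 := by
  have h₁ := fun t => (ha₁ t).hasDerivAt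
  have h₁' := fun t => (ha₁' t).hasDerivAt
  have h₁'' := fun t => (ha₁'' t).hasDerivAt
  have h₂ := fun t => (ha₂ t).hasDerivAt
  have h₂' := fun t => (ha₂' t).hasDerivAt
  have h₂'' := fun t => (ha₂'' t).hasDerivAt
  have hw₁ : ∀ t, HasDerivAt w (a₁ t * deriv (deriv a₂) t - a₂ t * deriv (deriv a₁) t) t := by
    intro t
    rw [hw]
    exact (((h₁ t).fun_mul (h₂' t)).fun_sub ((h₂ t).fun_mul (h₁' t))).congr_deriv (by ring)
  have hdw : deriv w = fun t => a₁ t * deriv (deriv a₂) t - a₂ t * deriv (deriv a₁) t :=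
    funext fun t => (hw₁ t).deriv
  have hw₂ : ∀ t, HasDerivAt (deriv w) (deriv a₁ t * deriv (deriv a₂) t
      - deriv a₂ t * deriv (deriv a₁) t - 4 * (p t * w t)) t := by
    intro t
    rw [hdw, hw]
    exact (((h₁ t).fun_mul (h₂'' t)).fun_sub ((h₂ t).fun_mul (h₁'' t))).congr_deriv
      (by linear_combination a₁ t * heq₂ t - a₂ t * heq₁ t)
  have hddw : deriv (deriv w) = fun t => deriv a₁ t * deriv (deriv a₂) t
      - deriv a₂ t * deriv (deriv a₁) t - 4 * (p t * w t) :=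
    funext fun t => (hw₂ t).deriv
  have hw₃ : ∀ t, HasDerivAt (deriv (deriv w))
      (-(4 * p t * deriv w t) - 2 * deriv p t * w t) t := by
    intro t
    rw [hddw]
    refine ((((h₁' t).fun_mul (h₂'' t)).fun_sub ((h₂' t).fun_mul (h₁'' t))).fun_sub
      (((hp t).hasDerivAt.fun_mul (hw₁ t)).const_mul 4)).congr_deriv ?_
    rw [hdw, hw]
    linear_combination deriv a₁ t * heq₂ t - deriv a₂ t * heq₁ t
  refine ⟨⟨fun t => (hw₁ t).differentiableAt, fun t => (hw₂ t).differentiableAt,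
    fun t => (hw₃ t).differentiableAt⟩, fun t => ?_⟩
  rw [(hw₃ t).deriv]
  ring
end

section
/- Let c₀, c₁ : ℝ → ℝ with c₁ differentiable and ċ₁(t) = 2c₀(t) for all t (the formally self-adjoint case, with c₂ ≡ 0). If a₁, a₂ : ℝ → ℝ are three times differentiable solutions of the third-order linear ODE a''' + c₁(t)a' + c₀(t)a = 0, then their Wronskian w₁₂ = a₁ȧ₂ − a₂ȧ₁ is also a solution of this equation: w₁₂''' + c₁(t)w₁₂' + c₀(t)w₁₂ = 0 for all t ∈ ℝ. -/
/-- For a formally self-adjoint third-order linear ODE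
`a''' + c₁(t)a' + c₀(t)a = 0` (i.e. `c₂ ≡ 0` and `ċ₁ = 2c₀`), the Wronskian
`w₁₂ = a₁ȧ₂ − a₂ȧ₁` of two three-times-differentiable solutions is again a solution. -/
theorem wronskian_of_self_adjoint_third_order_solutions_is_solution
    (c₀ c₁ : ℝ → ℝ) (hc₁ : Differentiable ℝ c₁)
    (hself : ∀ t : ℝ, deriv c₁ t = 2 * c₀ t)
    (a₁ a₂ : ℝ → ℝ)
    (ha₁ : Differentiable ℝ a₁) (ha₁' : Differentiable ℝ (deriv a₁))
    (ha₁'' : Differentiable ℝ (deriv (deriv a₁)))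
    (ha₂ : Differentiable ℝ a₂) (ha₂' : Differentiable ℝ (deriv a₂))
    (ha₂'' : Differentiable ℝ (deriv (deriv a₂)))
    (heq₁ : ∀ t : ℝ, deriv (deriv (deriv a₁)) t + c₁ t * deriv a₁ t + c₀ t * a₁ t = 0)
    (heq₂ : ∀ t : ℝ, deriv (deriv (deriv a₂)) t + c₁ t * deriv a₂ t + c₀ t * a₂ t = 0)
    (w : ℝ → ℝ) (hw : w = fun t => a₁ t * deriv a₂ t - a₂ t * deriv a₁ t) :
    ∀ t : ℝ, deriv (deriv (deriv w)) t + c₁ t * deriv w t + c₀ t * w t = 0 := by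
  have hw' : ∀ t, HasDerivAt w (a₁ t * deriv (deriv a₂) t - a₂ t * deriv (deriv a₁) t) t := by
    intro t
    rw [hw]
    refine (((ha₁ t).hasDerivAt.mul (ha₂' t).hasDerivAt).sub
      ((ha₂ t).hasDerivAt.mul (ha₁' t).hasDerivAt)).congr_deriv ?_
    ring
  have hdw : deriv w = fun t => a₁ t * deriv (deriv a₂) t - a₂ t * deriv (deriv a₁) t :=
    funext fun t => (hw' t).deriv
  have hddw : deriv (deriv w) = fun t =>
      deriv a₁ t * deriv (deriv a₂) t - deriv a₂ t * deriv (deriv a₁) t - c₁ t * w t := by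
    funext t
    rw [hdw]
    refine ((((ha₁ t).hasDerivAt.mul (ha₂'' t).hasDerivAt).sub
      ((ha₂ t).hasDerivAt.mul (ha₁'' t).hasDerivAt)).congr_deriv ?_).deriv
    rw [hw]
    linear_combination a₁ t * heq₂ t - a₂ t * heq₁ t
  intro t
  have hdddw : deriv (deriv (deriv w)) t =
      deriv a₁ t * deriv (deriv (deriv a₂)) t - deriv a₂ t * deriv (deriv (deriv a₁)) t
        - (deriv c₁ t * w t + c₁ t * deriv w t) := by
    rw [hddw]
    refine (((((ha₁' t).hasDerivAt.mul (ha₂'' t).hasDerivAt).sub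
      ((ha₂' t).hasDerivAt.mul (ha₁'' t).hasDerivAt)).sub
      ((hc₁ t).hasDerivAt.mul (hw' t).differentiableAt.hasDerivAt)).congr_deriv ?_).deriv
    ring
  have hwt : w t = a₁ t * deriv a₂ t - a₂ t * deriv a₁ t := congrFun hw t
  rw [hdddw, hself t]
  linear_combination deriv a₁ t * heq₂ t - deriv a₂ t * heq₁ t - c₀ t * hwt
end

section
/- Let p : ℝ → ℝ be continuous and let u₁, u₂ : ℝ → ℝ be twice differentiable solutions of Hill's equation ü + p(t)u = 0 with constant Wronskian W = u₁u̇₂ − u₂u̇₁. For real constants A, B, C, let a = Au₁² + 2Bu₁u₂ + Cu₂². Then for every t ∈ ℝ, (1/4)(2a(t)ä(t) − ȧ(t)²) + p(t)a(t)² = (AC − B²)·W². -/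
/-- If `u₁, u₂` are twice differentiable solutions of Hill's equation
with constant Wronskian `W`, then for `a = Au₁² + 2Bu₁u₂ + Cu₂²` the first integral
`(1/4)(2aä − ȧ²) + pa²` equals `(AC − B²)W²` everywhere. -/
theorem first_integral_value_for_quadratic_combination
    (p : ℝ → ℝ) (hp : Continuous p)
    (u₁ u₂ : ℝ → ℝ)
    (hu₁ : Differentiable ℝ u₁) (hu₁' : Differentiable ℝ (deriv u₁))
    (hu₂ : Differentiable ℝ u₂) (hu₂' : Differentiable ℝ (deriv u₂))
    (hHill₁ : ∀ t : ℝ, deriv (deriv u₁) t + p t * u₁ t = 0)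
    (hHill₂ : ∀ t : ℝ, deriv (deriv u₂) t + p t * u₂ t = 0)
    (W : ℝ) (hW : ∀ t : ℝ, u₁ t * deriv u₂ t - u₂ t * deriv u₁ t = W)
    (A B C : ℝ) (a : ℝ → ℝ)
    (ha : a = fun t => A * u₁ t ^ 2 + 2 * B * u₁ t * u₂ t + C * u₂ t ^ 2) :
    ∀ t : ℝ,
      (1 / 4) * (2 * a t * deriv (deriv a) t - (deriv a t) ^ 2) + p t * a t ^ 2
        = (A * C - B ^ 2) * W ^ 2 := by
  have hda : deriv a = fun t => 2 * (A * (u₁ t * deriv u₁ t)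
      + B * (deriv u₁ t * u₂ t + u₁ t * deriv u₂ t) + C * (u₂ t * deriv u₂ t)) := by
    funext t
    have h₁ := (hu₁ t).hasDerivAt
    have h₂ := (hu₂ t).hasDerivAt
    rw [ha]
    refine HasDerivAt.deriv ((((h₁.fun_pow 2).const_mul A).fun_add
      ((h₁.const_mul (2 * B)).fun_mul h₂)).fun_add
        ((h₂.fun_pow 2).const_mul C) |>.congr_deriv ?_)
    push_cast
    ring
  intro t
  have hdda : deriv (deriv a) t = 2 * (A * (deriv u₁ t ^ 2 + u₁ t * deriv (deriv u₁) t)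
      + B * (deriv (deriv u₁) t * u₂ t + 2 * deriv u₁ t * deriv u₂ t
        + u₁ t * deriv (deriv u₂) t)
      + C * (deriv u₂ t ^ 2 + u₂ t * deriv (deriv u₂) t)) := by
    have h₁ := (hu₁ t).hasDerivAt
    have h₂ := (hu₂ t).hasDerivAt
    have h₁' := (hu₁' t).hasDerivAt
    have h₂' := (hu₂' t).hasDerivAt
    rw [hda]
    refine HasDerivAt.deriv (((((h₁.fun_mul h₁').const_mul A).fun_add
      (((h₁'.fun_mul h₂).fun_add (h₁.fun_mul h₂')).const_mul B)).fun_add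
        ((h₂.fun_mul h₂').const_mul C)).const_mul 2 |>.congr_deriv ?_)
    ring
  rw [hdda, hda, ha, eq_neg_of_add_eq_zero_left (hHill₁ t),
    eq_neg_of_add_eq_zero_left (hHill₂ t), ← hW t]
  ring
end

section
/- For a differentiable function a : ℝ → ℝ, define the vector field V_a : ℝ² → ℝ² by V_a(t,x) = (a(t), (ȧ(t)/2)·x). Let a₁, a₂ : ℝ → ℝ be twice differentiable. Then the Lie bracket of V_{a₁} and V_{a₂}, defined pointwise by [V,W](q) = (D W)_q (V(q)) − (D V)_q (W(q)) where (DV)_q denotes the Fréchet derivative of V at q, satisfies [V_{a₁}, V_{a₂}] = V_{w} where w(t) = a₁(t)ȧ₂(t) − a₂(t)ȧ₁(t), i.e., for all (t,x) ∈ ℝ², [V_{a₁}, V_{a₂}](t,x) = (w(t), (ẇ(t)/2)x). -/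
/-- The Fréchet derivative of the planar field `(t, x) ↦ (a t, (deriv a t / 2) * x)`. -/
theorem fderiv_planar_field_apply {a : ℝ → ℝ} (ha : Differentiable ℝ a)
    (ha' : Differentiable ℝ (deriv a)) (q v : ℝ × ℝ) :
    fderiv ℝ (fun p : ℝ × ℝ => (a p.1, deriv a p.1 / 2 * p.2)) q v =
      (deriv a q.1 * v.1, deriv (deriv a) q.1 / 2 * v.1 * q.2 + deriv a q.1 / 2 * v.2) := by
  have h₁ := (ha q.1).hasDerivAt.comp_hasFDerivAt q (hasFDerivAt_fst (𝕜 := ℝ))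
  have h₂ := ((ha' q.1).hasDerivAt.div_const 2).comp_hasFDerivAt q (hasFDerivAt_fst (𝕜 := ℝ))
  have h := h₁.prodMk (h₂.mul (hasFDerivAt_snd (𝕜 := ℝ)))
  have key := congrArg (fun L : ℝ × ℝ →L[ℝ] ℝ × ℝ => L v) h.fderiv
  refine key.trans ?_
  ext
  · simp
  · simp
    ring


/-- For twice differentiable `a₁, a₂`, the Lie bracket of the planar
vector fields `V_a(t,x) = (a(t), (ȧ(t)/2)x)` satisfies `[V_{a₁}, V_{a₂}] = V_w`
with `w = a₁ȧ₂ − a₂ȧ₁` (the Wronskian). -/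
theorem lie_bracket_of_EP_symmetry_fields
    (a₁ a₂ : ℝ → ℝ)
    (ha₁ : Differentiable ℝ a₁) (ha₁' : Differentiable ℝ (deriv a₁))
    (ha₂ : Differentiable ℝ a₂) (ha₂' : Differentiable ℝ (deriv a₂))
    (V : (ℝ → ℝ) → (ℝ × ℝ → ℝ × ℝ))
    (hV : V = fun a q => (a q.1, deriv a q.1 / 2 * q.2))
    (w : ℝ → ℝ) (hw : w = fun t => a₁ t * deriv a₂ t - a₂ t * deriv a₁ t) :
    ∀ q : ℝ × ℝ,
      fderiv ℝ (V a₂) q (V a₁ q) - fderiv ℝ (V a₁) q (V a₂ q) = V w q := by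
  subst hV hw
  intro q
  have hw' : deriv (fun t => a₁ t * deriv a₂ t - a₂ t * deriv a₁ t) q.1 =
      a₁ q.1 * deriv (deriv a₂) q.1 - a₂ q.1 * deriv (deriv a₁) q.1 := by
    refine (((ha₁ q.1).hasDerivAt.mul (ha₂' q.1).hasDerivAt).sub
      ((ha₂ q.1).hasDerivAt.mul (ha₁' q.1).hasDerivAt)).deriv.trans ?_
    ring
  simp only [fderiv_planar_field_apply ha₁ ha₁', fderiv_planar_field_apply ha₂ ha₂', hw']
  ext
  · simp only [Prod.fst_sub]
    ring
  · simp only [Prod.snd_sub]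
    ring
end

section
/- Let k ∈ ℝ and α, β, γ, δ ∈ ℝ with αδ − βγ = 1. Let I ⊆ ℝ be an open interval on which γt + δ > 0, and let u : ℝ → ℝ be twice differentiable with u(τ) ≠ 0 and u''(τ) = k·u(τ)⁻³ for all τ. Then the function x(t) = (γt + δ)·u((αt + β)/(γt + δ)) satisfies ẍ(t) = k·x(t)⁻³ for all t ∈ I. -/
theorem hasDerivAt_mul_add_const (a b t : ℝ) : HasDerivAt (fun t => a * t + b) a t := by
  simpa using ((hasDerivAt_id t).const_mul a).add_const b

theorem hasDerivAt_mobius {α β γ δ t : ℝ} (hdet : α * δ - β * γ = 1) (ht : γ * t + δ ≠ 0) :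
    HasDerivAt (fun t => (α * t + β) / (γ * t + δ)) (1 / (γ * t + δ) ^ 2) t := by
  refine ((hasDerivAt_mul_add_const α β t).fun_div
    (hasDerivAt_mul_add_const γ δ t) ht).congr_deriv ?_
  congr 1
  linear_combination hdet

/-- First derivative of the transformed function `(γt + δ)·u((αt + β)/(γt + δ))`. -/
theorem hasDerivAt_mul_comp_mobius {α β γ δ t : ℝ} (hdet : α * δ - β * γ = 1)
    (ht : γ * t + δ ≠ 0) {u : ℝ → ℝ} (hu : Differentiable ℝ u) :
    HasDerivAt (fun t => (γ * t + δ) * u ((α * t + β) / (γ * t + δ)))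
      (γ * u ((α * t + β) / (γ * t + δ)) +
        deriv u ((α * t + β) / (γ * t + δ)) / (γ * t + δ)) t := by
  refine ((hasDerivAt_mul_add_const γ δ t).fun_mul
    ((hu _).hasDerivAt.comp t (hasDerivAt_mobius hdet ht))).congr_deriv ?_
  simp only [Function.comp_apply]
  field_simp

/-- Second derivative of the transformed function `(γt + δ)·u((αt + β)/(γt + δ))`. -/
theorem hasDerivAt_deriv_mul_comp_mobius {α β γ δ t : ℝ} (hdet : α * δ - β * γ = 1)
    (ht : γ * t + δ ≠ 0) {u : ℝ → ℝ} (hu : Differentiable ℝ u)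
    (hu' : Differentiable ℝ (deriv u)) :
    HasDerivAt (fun t => γ * u ((α * t + β) / (γ * t + δ)) +
        deriv u ((α * t + β) / (γ * t + δ)) / (γ * t + δ))
      (deriv (deriv u) ((α * t + β) / (γ * t + δ)) / (γ * t + δ) ^ 3) t := by
  have hs := hasDerivAt_mobius hdet ht
  refine ((((hu _).hasDerivAt.comp t hs).const_mul γ).fun_add
    (((hu' _).hasDerivAt.comp t hs).fun_div (hasDerivAt_mul_add_const γ δ t) ht)).congr_deriv ?_
  simp only [Function.comp_apply]
  field_simp
  ring

/-- The `SL(2,ℝ)` action preserves the canonical Ermakov–Pinney equation: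
if `u'' = k u⁻³` with `u` nonvanishing and `αδ − βγ = 1`, then on an open interval where
`γt + δ > 0`, `x(t) = (γt + δ)·u((αt + β)/(γt + δ))` satisfies `ẍ = k x⁻³`. -/
theorem sl2_action_preserves_canonical_EP
    (k α β γ δ : ℝ) (hdet : α * δ - β * γ = 1)
    (I : Set ℝ) (hIopen : IsOpen I) (hIconn : I.OrdConnected)
    (hpos : ∀ t ∈ I, γ * t + δ > 0)
    (u : ℝ → ℝ)
    (hu : Differentiable ℝ u) (hu' : Differentiable ℝ (deriv u))
    (hune : ∀ τ : ℝ, u τ ≠ 0)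
    (hEP : ∀ τ : ℝ, deriv (deriv u) τ = k * ((u τ) ^ 3)⁻¹)
    (x : ℝ → ℝ)
    (hx : x = fun t => (γ * t + δ) * u ((α * t + β) / (γ * t + δ))) :
    ∀ t ∈ I, deriv (deriv x) t = k * ((x t) ^ 3)⁻¹ := by
  subst hx
  intro t ht
  have hderiv : deriv (fun t => (γ * t + δ) * u ((α * t + β) / (γ * t + δ))) =ᶠ[nhds t]
      fun t => γ * u ((α * t + β) / (γ * t + δ)) +
        deriv u ((α * t + β) / (γ * t + δ)) / (γ * t + δ) := by
    filter_upwards [hIopen.mem_nhds ht] with s hs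
    exact (hasDerivAt_mul_comp_mobius hdet (hpos s hs).ne' hu).deriv
  rw [hderiv.deriv_eq, (hasDerivAt_deriv_mul_comp_mobius hdet (hpos t ht).ne' hu hu').deriv, hEP,
    mul_pow, mul_inv]
  ring
end

section
/- Let p : ℝ → ℝ be continuous, k ∈ ℝ, and let u₁, u₂ : ℝ → ℝ be twice differentiable solutions of Hill's equation ü + p(t)u = 0 whose Wronskian W = u₁u̇₂ − u₂u̇₁ is a nonzero constant. Let I ⊆ ℝ be an interval on which u₁(t) > 0. Suppose ξ : ℝ → ℝ is twice differentiable with ξ(τ) ≠ 0 and ξ''(τ) = k·ξ(τ)⁻³ for all τ. Then x(t) = ξ(u₂(t)/(W·u₁(t)))·u₁(t) satisfies the Ermakov–Pinney equation ẍ(t) + p(t)x(t) = k·x(t)⁻³ for all t ∈ I. -/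
/-- The new time `τ = u₂ / (W u₁)` has derivative `u₁⁻²`. -/
theorem hasDerivAt_div_wronskian_mul {u₁ u₂ : ℝ → ℝ} {W a b t : ℝ}
    (h₁ : HasDerivAt u₁ a t) (h₂ : HasDerivAt u₂ b t) (hW : u₁ t * b - u₂ t * a = W)
    (hWne : W ≠ 0) (ht : u₁ t ≠ 0) :
    HasDerivAt (fun s => u₂ s / (W * u₁ s)) ((u₁ t ^ 2)⁻¹) t := by
  refine (h₂.fun_div (h₁.const_mul W) (mul_ne_zero hWne ht)).congr_deriv ?_
  rw [show b * (W * u₁ t) - u₂ t * (W * a) = W * W by rw [← hW]; ring]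
  field_simp

/-- The change of variables `x = ξ(τ)u₁`, `τ = u₂/(W u₁)` maps solutions
`ξ'' = k ξ⁻³` of the canonical Ermakov–Pinney equation to solutions of
`ẍ + p(t)x = k x⁻³`, where `u₁, u₂` solve Hill's equation `ü + p(t)u = 0` with nonzero
constant Wronskian `W` and `u₁ > 0` on the interval `I`. -/
theorem canonical_EP_transforms_to_EP
    (p : ℝ → ℝ) (k : ℝ) (hp : Continuous p)
    (u₁ u₂ : ℝ → ℝ)
    (hu₁ : Differentiable ℝ u₁) (hu₁' : Differentiable ℝ (deriv u₁))
    (hu₂ : Differentiable ℝ u₂) (hu₂' : Differentiable ℝ (deriv u₂))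
    (hHill₁ : ∀ t : ℝ, deriv (deriv u₁) t + p t * u₁ t = 0)
    (hHill₂ : ∀ t : ℝ, deriv (deriv u₂) t + p t * u₂ t = 0)
    (W : ℝ) (hWne : W ≠ 0)
    (hW : ∀ t : ℝ, u₁ t * deriv u₂ t - u₂ t * deriv u₁ t = W)
    (I : Set ℝ) (hIconn : I.OrdConnected)
    (hu₁pos : ∀ t ∈ I, u₁ t > 0)
    (ξ : ℝ → ℝ)
    (hξ : Differentiable ℝ ξ) (hξ' : Differentiable ℝ (deriv ξ))
    (hξne : ∀ τ : ℝ, ξ τ ≠ 0)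
    (hcan : ∀ τ : ℝ, deriv (deriv ξ) τ = k * ((ξ τ) ^ 3)⁻¹)
    (x : ℝ → ℝ)
    (hx : x = fun t => ξ (u₂ t / (W * u₁ t)) * u₁ t) :
    ∀ t ∈ I, deriv (deriv x) t + p t * x t = k * ((x t) ^ 3)⁻¹ := by
  subst hx
  intro t ht
  have hpos : 0 < u₁ t := hu₁pos t ht
  have hτ (s : ℝ) (hs : u₁ s ≠ 0) :
      HasDerivAt (fun s => u₂ s / (W * u₁ s)) ((u₁ s ^ 2)⁻¹) s :=
    hasDerivAt_div_wronskian_mul (hu₁ s).hasDerivAt (hu₂ s).hasDerivAt (hW s) hWne hs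
  have hfirst (s : ℝ) (hs : u₁ s ≠ 0) :
      deriv (fun t => ξ (u₂ t / (W * u₁ t)) * u₁ t) s =
        deriv ξ (u₂ s / (W * u₁ s)) * (u₁ s)⁻¹ + ξ (u₂ s / (W * u₁ s)) * deriv u₁ s := by
    have h := ((hξ (u₂ s / (W * u₁ s))).hasDerivAt.comp s (hτ s hs)).mul (hu₁ s).hasDerivAt
    refine (h.congr_deriv ?_).deriv
    simp only [Function.comp_apply]
    field_simp
  have hev : deriv (fun t => ξ (u₂ t / (W * u₁ t)) * u₁ t) =ᶠ[nhds t] fun s =>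
      deriv ξ (u₂ s / (W * u₁ s)) * (u₁ s)⁻¹ + ξ (u₂ s / (W * u₁ s)) * deriv u₁ s :=
    (hu₁.continuous.continuousAt.eventually_ne hpos.ne').mono hfirst
  have hsecond :=
    (((hξ' (u₂ t / (W * u₁ t))).hasDerivAt.comp t (hτ t hpos.ne')).mul
      ((hu₁ t).hasDerivAt.inv hpos.ne')).add
    (((hξ (u₂ t / (W * u₁ t))).hasDerivAt.comp t (hτ t hpos.ne')).mul (hu₁' t).hasDerivAt)
  rw [hev.deriv_eq]
  refine (congrArg (· + _) hsecond.deriv).trans ?_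
  simp only [Function.comp_apply, Pi.inv_apply]
  rw [hcan, eq_neg_of_add_eq_zero_left (hHill₁ t)]
  have hξt := hξne (u₂ t / (W * u₁ t))
  generalize ξ (u₂ t / (W * u₁ t)) = y at *
  field_simp
  ring
end

section
/- Let a : ℝ → ℝ be twice differentiable with a(t) > 0, let ν = ȧ/a, let s : ℝ → ℝ be differentiable with ṡ(t) = 1/a(t), and let I ⊆ ℝ be an interval on which s(t) > 0. Let C₀ > 0 and let H : ℝ → ℝ satisfy H(C₀²/2) = −C₀⁴/4. Then x(t) = C₀·√(s(t)·a(t)) satisfies x(t)ẋ(t) − (ν(t)/2)x(t)² = C₀²/2 and the invariant equation ẍ − (1/4)(2ν̇ + ν²)x = x⁻³·H(xẋ − (ν/2)x²) for all t ∈ I. -/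
/-- First derivative of `C√(s·a)` where `s' = 1/a` and `s·a > 0`. -/
theorem hasDerivAt_const_mul_sqrt_mul {a s : ℝ → ℝ} {a₁ t : ℝ} (C : ℝ)
    (ha : HasDerivAt a a₁ t) (hs : HasDerivAt s (1 / a t) t)
    (hapos : 0 < a t) (hspos : 0 < s t) :
    HasDerivAt (fun t => C * √(s t * a t))
      (C * ((1 + s t * a₁) / (2 * √(s t * a t)))) t := by
  have hsa : HasDerivAt (fun t => s t * a t) (1 + s t * a₁) t := by
    simpa only [one_div_mul_cancel hapos.ne'] using hs.fun_mul ha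
  exact (hsa.sqrt (mul_pos hspos hapos).ne').const_mul C

/-- For `a` twice differentiable and positive, `ν = ȧ/a`, `s` an
antiderivative of `1/a` which is positive on the interval `I`, `C₀ > 0` and
`H(C₀²/2) = −C₀⁴/4`, the function `x = C₀√(s·a)` has invariant
`xẋ − (ν/2)x² = C₀²/2` and solves the affine-invariant equation
`ẍ − (1/4)(2ν̇ + ν²)x = x⁻³ H(xẋ − (ν/2)x²)` on `I`. -/
theorem invariant_solution_sqrt_sa
    (a : ℝ → ℝ)
    (ha : Differentiable ℝ a) (ha' : Differentiable ℝ (deriv a))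
    (hapos : ∀ t : ℝ, a t > 0)
    (ν : ℝ → ℝ) (hν : ν = fun t => deriv a t / a t)
    (s : ℝ → ℝ) (hs : Differentiable ℝ s)
    (hs' : ∀ t : ℝ, deriv s t = 1 / a t)
    (I : Set ℝ) (hIconn : I.OrdConnected)
    (hspos : ∀ t ∈ I, s t > 0)
    (C₀ : ℝ) (hC₀ : C₀ > 0)
    (H : ℝ → ℝ) (hH : H (C₀ ^ 2 / 2) = -C₀ ^ 4 / 4)
    (x : ℝ → ℝ) (hx : x = fun t => C₀ * Real.sqrt (s t * a t)) :
    ∀ t ∈ I,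
      x t * deriv x t - ν t / 2 * x t ^ 2 = C₀ ^ 2 / 2 ∧
      deriv (deriv x) t - (1 / 4) * (2 * deriv ν t + ν t ^ 2) * x t
        = ((x t) ^ 3)⁻¹ * H (x t * deriv x t - ν t / 2 * x t ^ 2) := by
  have ha_at (t : ℝ) : HasDerivAt a (deriv a t) t := (ha t).hasDerivAt
  have hs_at (t : ℝ) : HasDerivAt s (1 / a t) t := hs' t ▸ (hs t).hasDerivAt
  intro t ht
  have hst : 0 < s t := hspos t ht
  have hat : 0 < a t := hapos t
  have hdx : ∀ u, 0 < s u →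
      deriv x u = C₀ * ((1 + s u * deriv a u) / (2 * √(s u * a u))) := by
    intro u hu
    rw [hx]
    exact (hasDerivAt_const_mul_sqrt_mul C₀ (ha_at u) (hs_at u) (hapos u) hu).deriv
  have hdx_near : deriv x =ᶠ[nhds t]
      fun u => C₀ * ((1 + s u * deriv a u) / (2 * √(s u * a u))) :=
    (hs.continuous.continuousAt.eventually (lt_mem_nhds hst)).mono hdx
  have hr : 0 < √(s t * a t) := Real.sqrt_pos.2 (mul_pos hst hat)
  have hr_sq : √(s t * a t) ^ 2 = s t * a t := Real.sq_sqrt (mul_pos hst hat).le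
  have hnum : HasDerivAt (fun u => 1 + s u * deriv a u)
      (1 / a t * deriv a t + s t * deriv (deriv a) t) t :=
    ((hs_at t).fun_mul (ha' t).hasDerivAt).const_add 1
  have hden := hasDerivAt_const_mul_sqrt_mul 2 (ha_at t) (hs_at t) hat hst
  have hddx := hdx_near.deriv_eq.trans
    ((hnum.fun_div hden (mul_pos two_pos hr).ne').const_mul C₀).deriv
  have hdν : deriv ν t =
      (deriv (deriv a) t * a t - deriv a t * deriv a t) / a t ^ 2 := by
    rw [hν]
    exact ((ha' t).hasDerivAt.fun_div (ha_at t) hat.ne').deriv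
  have hxt : x t = C₀ * √(s t * a t) := by rw [hx]
  have hνt : ν t = deriv a t / a t := by rw [hν]
  have hinv : x t * deriv x t - ν t / 2 * x t ^ 2 = C₀ ^ 2 / 2 := by
    rw [hdx t hst, hxt, hνt, mul_pow, hr_sq]
    field_simp
    ring
  refine ⟨hinv, ?_⟩
  rw [hinv, hH, hddx, hdν, hxt, hνt]
  generalize √(s t * a t) = r at hr hr_sq
  have hs_eq : s t = r ^ 2 / a t := by
    rw [hr_sq]
    field_simp
  rw [hs_eq]
  field_simp
  ring
end

section
/- Let p : ℝ → ℝ be differentiable and let a : ℝ → ℝ be a three times differentiable, positive solution of the projective vector field equation a''' + 4p(t)a' + 2ṗ(t)a = 0, with (constant) first integral K = (1/4)(2aä − ȧ²) + pa². Let s : ℝ → ℝ be differentiable with ṡ = 1/a, let A, B, C, H₀ ∈ ℝ with AC − B² = H₀, and let I ⊆ ℝ be an interval on which A + 2Bs(t) + Cs(t)² > 0. Then x(t) = √(a(t)·(A + 2Bs(t) + Cs(t)²)) satisfies ẍ(t) + (p(t) − K·a(t)⁻²)x(t) = H₀·x(t)⁻³ for all t ∈ I. -/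
open Filter Topology in
/-- The second derivative of `√u` at a point where `u` is positive. -/
theorem deriv_deriv_sqrt_of_pos {u v : ℝ → ℝ} {w t : ℝ}
    (hu : ∀ y, HasDerivAt u (v y) y) (hv : HasDerivAt v w t) (hpos : 0 < u t) :
    deriv (deriv fun y => Real.sqrt (u y)) t
      = (2 * u t * w - v t ^ 2) / (4 * Real.sqrt (u t) ^ 3) := by
  have hfst : (deriv fun y => Real.sqrt (u y)) =ᶠ[𝓝 t] fun y => v y / (2 * Real.sqrt (u y)) := by
    filter_upwards [(hu t).continuousAt.eventually (lt_mem_nhds hpos)] with y hy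
    exact ((hu y).sqrt (ne_of_gt hy)).deriv
  have hsqrt : 0 < Real.sqrt (u t) := Real.sqrt_pos.2 hpos
  have hsnd := hv.div (((hu t).sqrt hpos.ne').const_mul 2) (by positivity)
  rw [hfst.deriv_eq]
  refine hsnd.deriv.trans ?_
  have hsq : u t = Real.sqrt (u t) ^ 2 := (Real.sq_sqrt hpos.le).symm
  generalize Real.sqrt (u t) = r at hsqrt hsq ⊢
  rw [hsq]
  field_simp
  ring

/-- Let `a` be a positive, three times differentiable solution of the
projective vector field equation `a''' + 4p a' + 2ṗ a = 0` with constant first integral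
`K = (1/4)(2aä − ȧ²) + pa²`, and let `ṡ = 1/a`, `AC − B² = H₀`.
Then `x(t) = √(a(t)(A + 2Bs(t) + Cs(t)²))` solves the Ermakov–Pinney equation with
modified potential: `ẍ + (p − K a⁻²)x = H₀ x⁻³` on any interval where
`A + 2Bs + Cs² > 0`. -/
theorem EP_with_modified_potential_general_solution
    (p a : ℝ → ℝ) (hp : Differentiable ℝ p)
    (ha : Differentiable ℝ a) (ha' : Differentiable ℝ (deriv a))
    (ha'' : Differentiable ℝ (deriv (deriv a)))
    (hapos : ∀ t : ℝ, a t > 0)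
    (hproj : ∀ t : ℝ, deriv (deriv (deriv a)) t + 4 * p t * deriv a t
      + 2 * deriv p t * a t = 0)
    (K : ℝ)
    (hK : ∀ t : ℝ,
      (1 / 4) * (2 * a t * deriv (deriv a) t - (deriv a t) ^ 2) + p t * a t ^ 2 = K)
    (s : ℝ → ℝ) (hs : Differentiable ℝ s)
    (hs' : ∀ t : ℝ, deriv s t = 1 / a t)
    (A B C H₀ : ℝ) (hH₀ : A * C - B ^ 2 = H₀)
    (I : Set ℝ) (hIconn : I.OrdConnected)
    (hpos : ∀ t ∈ I, A + 2 * B * s t + C * s t ^ 2 > 0)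
    (x : ℝ → ℝ)
    (hx : x = fun t => Real.sqrt (a t * (A + 2 * B * s t + C * s t ^ 2))) :
    ∀ t ∈ I,
      deriv (deriv x) t + (p t - K * ((a t) ^ 2)⁻¹) * x t = H₀ * ((x t) ^ 3)⁻¹ := by
  intro t ht
  have hane : ∀ y, a y ≠ 0 := fun y => (hapos y).ne'
  have hsd : ∀ y, HasDerivAt s (1 / a y) y := fun y => hs' y ▸ (hs y).hasDerivAt
  have hQ : ∀ y, HasDerivAt (fun y => A + 2 * B * s y + C * s y ^ 2)
      ((2 * B + 2 * C * s y) / a y) y := fun y => by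
    refine ((((hsd y).const_mul (2 * B)).const_add A).add
      (((hsd y).pow 2).const_mul C)).congr_deriv ?_
    push_cast
    ring
  have hu : ∀ y, HasDerivAt (fun y => a y * (A + 2 * B * s y + C * s y ^ 2))
      (deriv a y * (A + 2 * B * s y + C * s y ^ 2) + (2 * B + 2 * C * s y)) y := fun y => by
    refine ((ha y).hasDerivAt.mul (hQ y)).congr_deriv ?_
    rw [mul_div_cancel₀ _ (hane y)]
  have hv := ((ha' t).hasDerivAt.mul (hQ t)).add (((hsd t).const_mul (2 * C)).const_add (2 * B))
  have hupos : 0 < a t * (A + 2 * B * s t + C * s t ^ 2) := mul_pos (hapos t) (hpos t ht)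
  have hxdd := deriv_deriv_sqrt_of_pos hu hv hupos
  have hr : 0 < Real.sqrt (a t * (A + 2 * B * s t + C * s t ^ 2)) := Real.sqrt_pos.2 hupos
  have hr2 := Real.sq_sqrt hupos.le
  rw [hx, hxdd, ← hH₀, ← hK t]
  beta_reduce
  generalize Real.sqrt (a t * (A + 2 * B * s t + C * s t ^ 2)) = r at hr hr2 ⊢
  have hr4 : r ^ 4 = (a t * (A + 2 * B * s t + C * s t ^ 2)) ^ 2 := by rw [← hr2]; ring
  have hat := hane t
  field_simp
  rw [hr4]
  ring
end

section
/- Let n ≠ 1 be real, q ∈ ℝ, I : ℝ → ℝ continuous, and let u₁, u₂ : ℝ → ℝ be twice differentiable solutions of ü + I(t)u = 0 whose Wronskian W = u₁u̇₂ − u₂u̇₁ is constant and satisfies (AC − B²)W² = q for given A, B, C ∈ ℝ. On an interval where Q(t) = Au₁(t)² + 2Bu₁(t)u₂(t) + Cu₂(t)² > 0, the function z(t) = Q(t)^{2/(1−n)} satisfies the second-order Kummer–Schwarz equation z̈ + (4/(1−n))I(t)z = ((n+3)/4)·ż²/z + (4q/(1−n))·zⁿ. -/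
/-- First derivative of the binary quadratic form `A x² + 2 B x y + C y²` along a curve. -/
theorem HasDerivAt.quadraticForm {x y : ℝ → ℝ} {x' y' t : ℝ} (A B C : ℝ)
    (hx : HasDerivAt x x' t) (hy : HasDerivAt y y' t) :
    HasDerivAt (fun s => A * x s ^ 2 + 2 * B * x s * y s + C * y s ^ 2)
      (2 * (A * (x t * x') + B * (x t * y' + x' * y t) + C * (y t * y'))) t := by
  have h := (((hx.fun_pow 2).const_mul A).fun_add ((hx.const_mul (2 * B)).fun_mul hy)).fun_add
    ((hy.fun_pow 2).const_mul C)
  refine h.congr_deriv ?_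
  push_cast
  ring

/-- First derivative of the polarized form `2 (A x v + B (x w + v y) + C y w)` along a curve. -/
theorem HasDerivAt.polarizedQuadraticForm {x y v w : ℝ → ℝ} {x' y' v' w' t : ℝ} (A B C : ℝ)
    (hx : HasDerivAt x x' t) (hy : HasDerivAt y y' t)
    (hv : HasDerivAt v v' t) (hw : HasDerivAt w w' t) :
    HasDerivAt (fun s => 2 * (A * (x s * v s) + B * (x s * w s + v s * y s) + C * (y s * w s)))
      (2 * (A * (x' * v t + x t * v') + B * (x' * w t + x t * w' + (v' * y t + v t * y'))
        + C * (y' * w t + y t * w'))) t :=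
  (((hx.fun_mul hv).const_mul A).fun_add (((hx.fun_mul hw).fun_add (hv.fun_mul hy)).const_mul B)
    |>.fun_add ((hy.fun_mul hw).const_mul C)).const_mul 2

/-- Second derivative of a real power of a function that is positive at the point. -/
theorem deriv_deriv_rpow_const {Q P : ℝ → ℝ} {R t : ℝ} (a : ℝ)
    (hQ : ∀ s, HasDerivAt Q (P s) s) (hP : HasDerivAt P R t) (hpos : 0 < Q t) :
    deriv (deriv fun s => Q s ^ a) t =
      R * a * Q t ^ (a - 1) + P t * a * (P t * (a - 1) * Q t ^ (a - 2)) := by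
  have hev : deriv (fun s => Q s ^ a) =ᶠ[nhds t] fun s => P s * a * Q s ^ (a - 1) := by
    filter_upwards [(hQ t).continuousAt.eventually (lt_mem_nhds hpos)] with s hs
    exact ((hQ s).rpow_const (Or.inl hs.ne')).deriv
  rw [hev.deriv_eq]
  have h := (hP.mul_const a).fun_mul ((hQ t).rpow_const (p := a - 1) (Or.inl hpos.ne'))
  rw [h.deriv, show a - 1 - 1 = a - 2 by ring]

/-- Nonlinear superposition for the second-order Kummer–Schwarz
equation: if `u₁, u₂` solve `ü + I(t)u = 0` with constant Wronskian `W` and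
`(AC − B²)W² = q`, then on an interval where `Q = Au₁² + 2Bu₁u₂ + Cu₂² > 0`, the
function `z = Q^{2/(1−n)}` satisfies
`z̈ + (4/(1−n))I z = ((n+3)/4)ż²/z + (4q/(1−n))zⁿ`. -/
theorem kummer_schwarz_superposition
    (n q : ℝ) (hn : n ≠ 1)
    (I : ℝ → ℝ) (hI : Continuous I)
    (u₁ u₂ : ℝ → ℝ)
    (hu₁ : Differentiable ℝ u₁) (hu₁' : Differentiable ℝ (deriv u₁))
    (hu₂ : Differentiable ℝ u₂) (hu₂' : Differentiable ℝ (deriv u₂))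
    (heq₁ : ∀ t : ℝ, deriv (deriv u₁) t + I t * u₁ t = 0)
    (heq₂ : ∀ t : ℝ, deriv (deriv u₂) t + I t * u₂ t = 0)
    (W : ℝ) (hW : ∀ t : ℝ, u₁ t * deriv u₂ t - u₂ t * deriv u₁ t = W)
    (A B C : ℝ) (hq : (A * C - B ^ 2) * W ^ 2 = q)
    (Q : ℝ → ℝ)
    (hQ : Q = fun t => A * u₁ t ^ 2 + 2 * B * u₁ t * u₂ t + C * u₂ t ^ 2)
    (J : Set ℝ) (hJconn : J.OrdConnected)
    (hQpos : ∀ t ∈ J, Q t > 0)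
    (z : ℝ → ℝ) (hz : z = fun t => Q t ^ (2 / (1 - n))) :
    ∀ t ∈ J,
      deriv (deriv z) t + (4 / (1 - n)) * I t * z t
        = ((n + 3) / 4) * (deriv z t) ^ 2 / z t + (4 * q / (1 - n)) * z t ^ n := by
  intro t ht
  have hpos : 0 < Q t := hQpos t ht
  have h₁ (s : ℝ) : HasDerivAt u₁ (deriv u₁ s) s := (hu₁ s).hasDerivAt
  have h₂ (s : ℝ) : HasDerivAt u₂ (deriv u₂ s) s := (hu₂ s).hasDerivAt
  have hQ' (s : ℝ) := (h₁ s).quadraticForm A B C (h₂ s)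
  rw [← hQ] at hQ'
  have hQ'' := (h₁ t).polarizedQuadraticForm A B C (h₂ t) (hu₁' t).hasDerivAt (hu₂' t).hasDerivAt
  have hn' : 1 - n ≠ 0 := sub_ne_zero.mpr hn.symm
  have hz' := ((hQ' t).rpow_const (p := 2 / (1 - n)) (Or.inl hpos.ne')).deriv
  have hz'' := deriv_deriv_rpow_const (2 / (1 - n)) hQ' hQ'' hpos
  rw [← hz] at hz' hz''
  have hzt : z t = Q t ^ (2 / (1 - n)) := by rw [hz]
  have hzn : z t ^ n = Q t ^ (2 / (1 - n) - 2) := by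
    rw [hzt, ← Real.rpow_mul hpos.le]
    congr 1
    field_simp
    ring
  rw [hz', hz'', hzn, hzt]
  have hu₁'' : deriv (deriv u₁) t = -(I t * u₁ t) := eq_neg_of_add_eq_zero_left (heq₁ t)
  have hu₂'' : deriv (deriv u₂) t = -(I t * u₂ t) := eq_neg_of_add_eq_zero_left (heq₂ t)
  have hQt : Q t = A * u₁ t ^ 2 + 2 * B * u₁ t * u₂ t + C * u₂ t ^ 2 := by rw [hQ]
  rw [hu₁'', hu₂'', ← hq, ← hW t]
  set a := 2 / (1 - n) with ha
  have ha0 : a ≠ 0 := div_ne_zero two_ne_zero hn'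
  have hna : n = 1 - 2 / a := by rw [ha]; field_simp; ring
  have h4 (c : ℝ) : 4 * c / (1 - n) = 2 * a * c := by rw [ha]; ring
  have h4' : 4 / (1 - n) = 2 * a := by rw [ha]; ring
  have hσ : (n + 3) / 4 = 1 - 1 / (2 * a) := by rw [hna]; field_simp; ring
  rw [h4, h4', hσ, Real.rpow_sub hpos, Real.rpow_sub hpos, Real.rpow_one, Real.rpow_two]
  have hX : Q t ^ a ≠ 0 := (Real.rpow_pos_of_pos hpos a).ne'
  generalize Q t ^ a = X at hX ⊢
  have hQ0 := hpos.ne'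
  clear_value a
  field_simp
  rw [hQt]
  ring
end

section
/- Let n ≠ 1 be real, q ∈ ℝ, let p, r : ℝ → ℝ with r differentiable and p continuous, and let ρ : ℝ → ℝ be an antiderivative of r (ρ̇ = r). Let u₁, u₂ : ℝ → ℝ be twice differentiable solutions of ü + [p(t) − (1/4)(r(t)² + 2ṙ(t))]u = 0 with constant Wronskian W satisfying (AC − B²)W² = q for given A, B, C ∈ ℝ. On an interval where Q = Au₁² + 2Bu₁u₂ + Cu₂² > 0, the function w(t) = exp((2/(n−1))ρ(t))·Q(t)^{2/(1−n)} satisfies the dissipative second-order Kummer–Schwarz equation ẅ + r(t)ẇ + (4p(t)/(1−n))w = ((n+3)/4)·ẇ²/w + (4q/(1−n))·exp(−2ρ(t))·wⁿ. -/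
/-- Derivative of the quadratic form `A u² + 2B u v + C v²` along two functions. -/
theorem hasDerivAt_quadraticForm (A B C : ℝ) {u v : ℝ → ℝ} {u' v' t : ℝ}
    (hu : HasDerivAt u u' t) (hv : HasDerivAt v v' t) :
    HasDerivAt (fun s => A * u s ^ 2 + 2 * B * u s * v s + C * v s ^ 2)
      (2 * (A * u t * u' + B * (u' * v t + u t * v') + C * v t * v')) t := by
  have h := (((hu.pow 2).const_mul A).add ((hu.const_mul (2 * B)).mul hv)).add
    ((hv.pow 2).const_mul C)
  refine (h.congr_deriv ?_).congr_of_eventuallyEq (.of_forall fun s => ?_)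
  · push_cast
    ring
  · simp

/-- Logarithmic differentiation of `exp (a ρ) Q ^ b` where `Q` is positive. -/
theorem hasDerivAt_exp_mul_rpow (a b : ℝ) {ρ Q : ℝ → ℝ} {ρ' Q' t : ℝ}
    (hρ : HasDerivAt ρ ρ' t) (hQ : HasDerivAt Q Q' t) (hpos : 0 < Q t) :
    HasDerivAt (fun s => Real.exp (a * ρ s) * Q s ^ b)
      (Real.exp (a * ρ t) * Q t ^ b * (a * ρ' + b * (Q' / Q t))) t := by
  refine ((hρ.const_mul a).exp.mul (hQ.rpow_const (p := b) (Or.inl hpos.ne'))).congr_deriv ?_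
  rw [Real.rpow_sub_one hpos.ne']
  ring

/-- General solution of the dissipative second-order Kummer–Schwarz
equation: if `u₁, u₂` solve `ü + [p − (1/4)(r² + 2ṙ)]u = 0` with constant Wronskian
`W`, `(AC − B²)W² = q`, and `ρ̇ = r`, then on an interval where
`Q = Au₁² + 2Bu₁u₂ + Cu₂² > 0`, the function
`w = exp((2/(n−1))ρ)·Q^{2/(1−n)}` satisfies
`ẅ + r ẇ + (4p/(1−n))w = ((n+3)/4)ẇ²/w + (4q/(1−n))e^{−2ρ}wⁿ`. -/
theorem dissipative_kummer_schwarz_general_solution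
    (n q : ℝ) (hn : n ≠ 1)
    (p r : ℝ → ℝ) (hp : Continuous p) (hr : Differentiable ℝ r)
    (ρ : ℝ → ℝ) (hρ : Differentiable ℝ ρ) (hρ' : ∀ t : ℝ, deriv ρ t = r t)
    (u₁ u₂ : ℝ → ℝ)
    (hu₁ : Differentiable ℝ u₁) (hu₁' : Differentiable ℝ (deriv u₁))
    (hu₂ : Differentiable ℝ u₂) (hu₂' : Differentiable ℝ (deriv u₂))
    (heq₁ : ∀ t : ℝ, deriv (deriv u₁) t
      + (p t - (1 / 4) * (r t ^ 2 + 2 * deriv r t)) * u₁ t = 0)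
    (heq₂ : ∀ t : ℝ, deriv (deriv u₂) t
      + (p t - (1 / 4) * (r t ^ 2 + 2 * deriv r t)) * u₂ t = 0)
    (W : ℝ) (hW : ∀ t : ℝ, u₁ t * deriv u₂ t - u₂ t * deriv u₁ t = W)
    (A B C : ℝ) (hq : (A * C - B ^ 2) * W ^ 2 = q)
    (Q : ℝ → ℝ)
    (hQ : Q = fun t => A * u₁ t ^ 2 + 2 * B * u₁ t * u₂ t + C * u₂ t ^ 2)
    (J : Set ℝ) (hJconn : J.OrdConnected)
    (hQpos : ∀ t ∈ J, Q t > 0)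
    (w : ℝ → ℝ)
    (hw : w = fun t => Real.exp ((2 / (n - 1)) * ρ t) * Q t ^ (2 / (1 - n))) :
    ∀ t ∈ J,
      deriv (deriv w) t + r t * deriv w t + (4 * p t / (1 - n)) * w t
        = ((n + 3) / 4) * (deriv w t) ^ 2 / w t
          + (4 * q / (1 - n)) * Real.exp (-2 * ρ t) * w t ^ n := by
  intro t ht
  have hn1 : 1 - n ≠ 0 := sub_ne_zero.mpr hn.symm
  obtain ⟨b, hb⟩ : ∃ b, b = 2 / (1 - n) := ⟨_, rfl⟩
  have hb0 : b ≠ 0 := hb ▸ div_ne_zero two_ne_zero hn1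
  have hnb : n = 1 - 2 / b := by rw [hb]; field_simp; ring
  have ha : 2 / (n - 1) = -b := by rw [hb, ← neg_sub 1 n, div_neg]
  have hb4 : ∀ x, 4 * x / (1 - n) = 2 * b * x := fun x => by rw [hb]; ring
  rw [ha, ← hb] at hw
  let Q₁ : ℝ → ℝ := fun s => 2 * (A * u₁ s * deriv u₁ s
    + B * (deriv u₁ s * u₂ s + u₁ s * deriv u₂ s) + C * u₂ s * deriv u₂ s)
  have hQd : ∀ s, HasDerivAt Q (Q₁ s) s := fun s => by
    rw [hQ]
    exact hasDerivAt_quadraticForm A B C (hu₁ s).hasDerivAt (hu₂ s).hasDerivAt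
  have hQ₁d : HasDerivAt Q₁ (2 * (A * deriv u₁ t ^ 2 + 2 * B * deriv u₁ t * deriv u₂ t
      + C * deriv u₂ t ^ 2) - 2 * (p t - (1 / 4) * (r t ^ 2 + 2 * deriv r t)) * Q t) t := by
    have d₁ := (hu₁ t).hasDerivAt
    have d₂ := (hu₂ t).hasDerivAt
    have e₁ := (hu₁' t).hasDerivAt
    have e₂ := (hu₂' t).hasDerivAt
    refine (((((d₁.const_mul A).mul e₁).add (((e₁.mul d₂).add (d₁.mul e₂)).const_mul B)).add
      ((d₂.const_mul C).mul e₂)).const_mul 2).congr_deriv ?_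
    rw [eq_neg_of_add_eq_zero_left (heq₁ t), eq_neg_of_add_eq_zero_left (heq₂ t), hQ]
    ring
  have hρd : ∀ s, HasDerivAt ρ (r s) s := fun s => hρ' s ▸ (hρ s).hasDerivAt
  have hQt : 0 < Q t := hQpos t ht
  have hwd : ∀ s, 0 < Q s → HasDerivAt w (w s * (-b * r s + b * (Q₁ s / Q s))) s := fun s hs => by
    rw [hw]
    exact hasDerivAt_exp_mul_rpow (-b) b (hρd s) (hQd s) hs
  have hev : deriv w =ᶠ[nhds t] fun s => w s * (-b * r s + b * (Q₁ s / Q s)) :=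
    ((hQd t).continuousAt.eventually (lt_mem_nhds hQt)).mono fun s hs => (hwd s hs).deriv
  have hw₂ := ((hwd t hQt).mul (((hr t).hasDerivAt.const_mul (-b)).add
    ((hQ₁d.div (hQd t) hQt.ne').const_mul b))).congr_of_eventuallyEq hev
  have hwt : 0 < w t := by
    rw [hw]
    positivity
  have hpow : Real.exp (-2 * ρ t) * w t ^ n = w t / Q t ^ 2 := by
    have hw' : w t ^ (n - 1) = Real.exp (2 * ρ t) / Q t ^ 2 := by
      have hbn : b * (n - 1) = -2 := by rw [hnb]; field_simp; ring
      have hQn : (Q t ^ b) ^ (n - 1) = (Q t ^ 2)⁻¹ := by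
        rw [← Real.rpow_mul hQt.le, hbn, Real.rpow_neg hQt.le, Real.rpow_two]
      have hexp : -b * ρ t * (n - 1) = 2 * ρ t := by linear_combination (-ρ t) * hbn
      simp only [hw]
      rw [Real.mul_rpow (Real.exp_pos _).le (Real.rpow_nonneg hQt.le b), hQn, ← Real.exp_mul,
        hexp, div_eq_mul_inv]
    have hsplit : w t ^ n = w t ^ (n - 1) * w t := by
      rw [← Real.rpow_add_one hwt.ne', sub_add_cancel]
    rw [hsplit, hw', neg_mul, Real.exp_neg]
    field_simp
  have hdisc : Q t * (A * deriv u₁ t ^ 2 + 2 * B * deriv u₁ t * deriv u₂ t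
      + C * deriv u₂ t ^ 2) - (Q₁ t / 2) ^ 2 = q := by
    rw [← hq, ← hW t, hQ]
    ring
  rw [mul_assoc _ (Real.exp _), hpow, hw₂.deriv, (hwd t hQt).deriv, hb4, hb4, ← hdisc, hnb]
  simp only [Pi.div_apply, Pi.add_apply]
  generalize Q₁ t = y, Q t = x at *
  have hx := hQt.ne'
  have hz := hwt.ne'
  field_simp
  ring
end

section
/- Let r : ℝ → ℝ be twice differentiable on an interval I with r'(s) + r(s)² ≠ 0 for all s ∈ I. Then the Euler–Lagrange expression of the Lagrangian L(r, r') = 1/(r' + r²) satisfies, for all s ∈ I: (d/ds)(−(r'(s) + r(s)²)⁻²) + 2r(s)·(r'(s) + r(s)²)⁻² = 2(r''(s) + 3r(s)r'(s) + r(s)³)/(r'(s) + r(s)²)³. In particular, r satisfies the Euler–Lagrange equation of L if and only if r'' + 3rr' + r³ = 0 on I. -/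
/-- The total derivative of `∂L/∂r' = -(r' + r²)⁻²` along a curve for `L = 1/(r' + r²)`. -/
theorem hasDerivAt_neg_inv_sq_deriv_add_sq {r : ℝ → ℝ} {s : ℝ}
    (hr : DifferentiableAt ℝ r s) (hr' : DifferentiableAt ℝ (deriv r) s)
    (hne : deriv r s + r s ^ 2 ≠ 0) :
    HasDerivAt (fun σ => -((deriv r σ + r σ ^ 2) ^ 2)⁻¹)
      (2 * (deriv (deriv r) s + 2 * r s * deriv r s) / (deriv r s + r s ^ 2) ^ 3) s := by
  have h := (((hr'.hasDerivAt.fun_add (hr.hasDerivAt.fun_pow 2)).fun_pow 2).fun_inv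
    (pow_ne_zero 2 hne)).fun_neg
  refine h.congr_deriv ?_
  field_simp
  push_cast
  ring

/-- The Euler–Lagrange expression of the Lagrangian `L = 1/(r' + r²)`
equals `2(r'' + 3rr' + r³)/(r' + r²)³` on an interval where `r' + r² ≠ 0`; in
particular `r` satisfies the Euler–Lagrange equation of `L` on `I` if and only if it
satisfies the modified Emden equation `r'' + 3rr' + r³ = 0` on `I`. -/
theorem euler_lagrange_of_reciprocal_lagrangian_is_modified_emden
    (r : ℝ → ℝ)
    (hr : Differentiable ℝ r) (hr' : Differentiable ℝ (deriv r))
    (I : Set ℝ) (hIconn : I.OrdConnected)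
    (hne : ∀ s ∈ I, deriv r s + r s ^ 2 ≠ 0) :
    (∀ s ∈ I,
      deriv (fun σ => -((deriv r σ + r σ ^ 2) ^ 2)⁻¹) s
        + 2 * r s * ((deriv r s + r s ^ 2) ^ 2)⁻¹
      = 2 * (deriv (deriv r) s + 3 * r s * deriv r s + r s ^ 3)
          / (deriv r s + r s ^ 2) ^ 3) ∧
    ((∀ s ∈ I,
        deriv (fun σ => -((deriv r σ + r σ ^ 2) ^ 2)⁻¹) s
          + 2 * r s * ((deriv r s + r s ^ 2) ^ 2)⁻¹ = 0) ↔
      (∀ s ∈ I,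
        deriv (deriv r) s + 3 * r s * deriv r s + r s ^ 3 = 0)) := by
  have euler_lagrange_eq : ∀ s ∈ I,
      deriv (fun σ => -((deriv r σ + r σ ^ 2) ^ 2)⁻¹) s
        + 2 * r s * ((deriv r s + r s ^ 2) ^ 2)⁻¹
      = 2 * (deriv (deriv r) s + 3 * r s * deriv r s + r s ^ 3)
          / (deriv r s + r s ^ 2) ^ 3 := by
    intro s hs
    have hu := hne s hs
    rw [(hasDerivAt_neg_inv_sq_deriv_add_sq (hr s) (hr' s) hu).deriv]
    field_simp
    ring
  refine ⟨euler_lagrange_eq, forall₂_congr fun s hs => ?_⟩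
  rw [euler_lagrange_eq s hs]
  simp [hne s hs]
end
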